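/- arXiv:1512.02786 — 10 statements merged into one kernel-verified Lean document; each statement's English description precedes it below -/
import Mathlib

section
/- A BCN is not reconstructible if and only if for every p ∈ ℕ and every input word u_0 … u_{p-1} ∈ U^p there exist initial states x_0 ≠ x̄_0 whose state trajectories x_0, …, x_p and x̄_0, …, x̄_p satisfy x_i ≠ x̄_i for every 0 ≤ i ≤ p and h(x_i) = h(x̄_i) for every 0 ≤ i ≤ p. -/
/-- The state trajectory of a Boolean control network with transition map
`f : U → X → X`, driven by the input sequence `u` from initial state `x0`:
`traj f u x0 0 = x0` and `traj f u x0 (i+1) = f (u i) (traj f u x0 i)`. -/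
def traj {X U : Type*} (f : U → X → X) (u : ℕ → U) (x0 : X) : ℕ → X
  | 0 => x0
  | i + 1 => f (u i) (traj f u x0 i)

/-- The input word `u 0, …, u (p-1)` is homing: for all initial states,
equality of the output sequences `h (x i)`, `0 ≤ i ≤ p`, implies equality
of the final states at time `p`. -/
def Homing {X U Y : Type*} (f : U → X → X) (h : X → Y) (p : ℕ) (u : ℕ → U) : Prop :=
  ∀ x0 x0' : X,
    (∀ i ≤ p, h (traj f u x0 i) = h (traj f u x0' i)) →
    traj f u x0 p = traj f u x0' p

/-- A BCN is reconstructible if some input word (of some length `p ≥ 0`) is homing. -/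
def Reconstructible {X U Y : Type*} (f : U → X → X) (h : X → Y) : Prop :=
  ∃ (p : ℕ) (u : ℕ → U), Homing f h p u

/-- A BCN is Fornasini-reconstructible if for some length `p ≥ 0`,
every input word of length `p` is homing. -/
def FornasiniReconstructible {X U Y : Type*} (f : U → X → X) (h : X → Y) : Prop :=
  ∃ p : ℕ, ∀ u : ℕ → U, Homing f h p u

/-- A BCN is not reconstructible iff for every `p ∈ ℕ` and every input word
of length `p` there exist distinct initial states whose state trajectories
are pointwise distinct on `[0, p]` and produce the same output sequence on `[0, p]`. -/
theorem not_reconstructible_iff_pointwise_distinct_pairs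
    {X U Y : Type*} [Fintype X] [Fintype U] [Fintype Y]
    [Nonempty X] [Nonempty U] [Nonempty Y]
    (f : U → X → X) (h : X → Y) :
    ¬ Reconstructible f h ↔
      ∀ (p : ℕ) (u : ℕ → U), ∃ x0 x0' : X, x0 ≠ x0' ∧
        (∀ i ≤ p, traj f u x0 i ≠ traj f u x0' i) ∧
        (∀ i ≤ p, h (traj f u x0 i) = h (traj f u x0' i)) := by
  constructor
  · intro hn p u
    by_contra hc
    refine hn ⟨p, u, fun x0 x0' hh => ?_⟩
    by_contra hne
    have key : ∀ i ≤ p, traj f u x0 i ≠ traj f u x0' i := by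
      intro i hi heq
      have step : ∀ j, i ≤ j → traj f u x0 j = traj f u x0' j := by
        intro j hj
        induction j, hj using Nat.le_induction with
        | base => exact heq
        | succ k _ ih => simp only [traj, ih]
      exact hne (step p hi)
    exact hc ⟨x0, x0', key 0 (Nat.zero_le p), key, hh⟩
  · rintro hall ⟨p, u, hom⟩
    obtain ⟨x0, x0', _, hd, hh⟩ := hall p u
    exact hd p le_rfl (hom x0 x0' hh)
end

section
/- Let V denote the vertex set of the weighted pair graph of a BCN, and for S ⊆ V and u ∈ U let step(S, u) = {v' ∈ V | some v ∈ S has an edge labeled u to v'}; for an input word w, let run(V, w) denote the result of iterating step from the full vertex set V along the letters of w (with run(V, ε) = V). Then the BCN is not reconstructible if and only if run(V, w) is nonempty for every input word w ∈ U* (in particular V itself is nonempty); this says exactly that the determinized automaton A_V built on subsets of V recognizes the full language U*. -/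
/-- The vertex set of the weighted pair graph of a BCN: pairs of distinct
states producing the same output (encoded as ordered pairs; the encoding is
symmetric under swapping, matching the unordered pairs of the paper). -/
def pairVertices {X Y : Type*} (h : X → Y) : Set (X × X) :=
  {v | v.1 ≠ v.2 ∧ h v.1 = h v.2}

/-- There is an edge labeled `u` from vertex `{v.1, v.2}` to vertex `{v'.1, v'.2}`
in the weighted pair graph. -/
def pairEdge {X U : Type*} (f : U → X → X) (u : U) (v v' : X × X) : Prop :=
  (f u v.1 = v'.1 ∧ f u v.2 = v'.2) ∨ (f u v.1 = v'.2 ∧ f u v.2 = v'.1)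

/-- The subset transition of the determinized automaton `A_V` built on subsets of
the vertex set of the weighted pair graph:
`pairStep f h S u = {v' ∈ V | some v ∈ S has an edge labeled u to v'}`. -/
def pairStep {X U Y : Type*} (f : U → X → X) (h : X → Y)
    (S : Set (X × X)) (u : U) : Set (X × X) :=
  {v' ∈ pairVertices h | ∃ v ∈ S, pairEdge f u v v'}

/-- Iterating `pairStep` from a set `S` of vertices along the letters of a word `w`,
with `pairRun f h S [] = S`. -/
def pairRun {X U Y : Type*} (f : U → X → X) (h : X → Y)
    (S : Set (X × X)) (w : List U) : Set (X × X) :=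
  w.foldl (pairStep f h) S

theorem mem_pairRun_iff {X U Y : Type*} (f : U → X → X) (h : X → Y) (u : ℕ → U) (p : ℕ) :
    ∀ v : X × X, v ∈ pairRun f h (pairVertices h) ((List.range p).map u) ↔
      v.1 ≠ v.2 ∧ ∃ x0 x0' : X, (∀ i ≤ p, h (traj f u x0 i) = h (traj f u x0' i)) ∧
        traj f u x0 p = v.1 ∧ traj f u x0' p = v.2 := by
  induction p with
  | zero =>
    rintro ⟨a, b⟩
    simp [pairRun, pairVertices, traj]
  | succ p ih =>
    rintro ⟨a, b⟩
    have e : pairRun f h (pairVertices h) ((List.range (p + 1)).map u) =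
        pairStep f h (pairRun f h (pairVertices h) ((List.range p).map u)) (u p) := by
      simp [pairRun, List.range_succ]
    rw [e]
    constructor
    · rintro ⟨⟨hne, hh⟩, ⟨c, d⟩, hv, hedge⟩
      obtain ⟨hcd, x, x', hx, h1, h2⟩ := (ih _).1 hv
      simp only at hne hh h1 h2
      refine ⟨hne, ?_⟩
      rcases hedge with ⟨e1, e2⟩ | ⟨e1, e2⟩
      · simp only at e1 e2
        have t1 : traj f u x (p + 1) = a := by simp [traj, h1, e1]
        have t2 : traj f u x' (p + 1) = b := by simp [traj, h2, e2]
        refine ⟨x, x', ?_, t1, t2⟩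
        intro i hi
        rcases Nat.le_succ_iff.1 hi with hi | rfl
        · exact hx i hi
        · rw [t1, t2, hh]
      · simp only at e1 e2
        have t1 : traj f u x (p + 1) = b := by simp [traj, h1, e1]
        have t2 : traj f u x' (p + 1) = a := by simp [traj, h2, e2]
        refine ⟨x', x, ?_, t2, t1⟩
        intro i hi
        rcases Nat.le_succ_iff.1 hi with hi | rfl
        · exact (hx i hi).symm
        · rw [t1, t2, hh]
    · rintro ⟨hne, x, x', hx, h1, h2⟩
      simp only at hne h1 h2
      have hl := hx (p + 1) le_rfl
      rw [h1, h2] at hl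
      refine ⟨⟨hne, hl⟩, (traj f u x p, traj f u x' p), (ih _).2 ⟨?_, x, x', ?_, rfl, rfl⟩,
        Or.inl ⟨h1, h2⟩⟩
      · intro hc
        simp only at hc
        apply hne
        rw [← h1, ← h2]
        simp [traj, hc]
      · exact fun i hi => hx i (Nat.le_succ_of_le hi)

theorem not_homing_iff {X U Y : Type*} (f : U → X → X) (h : X → Y) (u : ℕ → U) (p : ℕ) :
    ¬ Homing f h p u ↔ (pairRun f h (pairVertices h) ((List.range p).map u)).Nonempty := by
  constructor
  · intro hn
    unfold Homing at hn
    push Not at hn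
    obtain ⟨x, x', hx, hne⟩ := hn
    exact ⟨(_, _), (mem_pairRun_iff f h u p _).2 ⟨hne, x, x', hx, rfl, rfl⟩⟩
  · rintro ⟨v, hv⟩ hH
    obtain ⟨hne, x, x', hx, h1, h2⟩ := (mem_pairRun_iff f h u p v).1 hv
    exact hne (h1 ▸ h2 ▸ hH x x' hx)

/-- A BCN is not reconstructible iff, starting from the full vertex set of its
weighted pair graph, the run of the determinized automaton `A_V` along every
input word is nonempty, i.e. `A_V` recognizes the full language `U^*`. -/
theorem not_reconstructible_iff_pairRun_nonempty
    {X U Y : Type*} [Fintype X] [Fintype U] [Fintype Y]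
    [Nonempty X] [Nonempty U] [Nonempty Y]
    (f : U → X → X) (h : X → Y) :
    ¬ Reconstructible f h ↔
      ∀ w : List U, (pairRun f h (pairVertices h) w).Nonempty := by
  constructor
  · intro hR w
    obtain ⟨u0⟩ := ‹Nonempty U›
    have e : (List.range w.length).map (fun i => w.getD i u0) = w := by
      apply List.ext_getElem <;> simp +contextual
    have := (not_homing_iff f h (fun i => w.getD i u0) w.length).1 (fun hH => hR ⟨_, _, hH⟩)
    rwa [e] at this
  · rintro hw ⟨p, u, hH⟩
    exact (not_homing_iff f h u p).2 (hw _) hH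
end

section
/- Assume the weight function satisfies the determinism condition: for every v ∈ V and all u_1 ≠ u_2 in V, W(v, u_1) ∩ W(v, u_2) = ∅. Then the following are equivalent: (a) V is nonempty and run(S_0, w) ≠ ∅ for S_0 = V and every word w over Σ (i.e., the determinized automaton built from the graph recognizes the full language Σ*); (b) the graph has a complete subgraph. -/
/-- Vertex `v` has full outdegree: for every letter `a` there is an edge
from `v` whose weight contains `a`. -/
def FullOutdeg {V A : Type*} (W : V → V → Finset A) (v : V) : Prop :=
  ∀ a : A, ∃ u : V, a ∈ W v u

/-- `Reach W v u`: there is a (possibly empty) path from `v` to `u` along edges,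
where there is an edge from `v` to `u` iff `W v u ≠ ∅`. -/
def Reach {V A : Type*} (W : V → V → Finset A) : V → V → Prop :=
  Relation.ReflTransGen (fun v u => (W v u).Nonempty)

/-- A complete subgraph: a nonempty set `P` of vertices such that every vertex of
`P` has, for each letter `a`, an edge labeled `a` to a vertex of `P`. -/
def CompleteSubgraph {V A : Type*} (W : V → V → Finset A) (P : Set V) : Prop :=
  P.Nonempty ∧ ∀ v ∈ P, ∀ a : A, ∃ u ∈ P, a ∈ W v u

/-- The subset transition: `gStep W S a = {u | ∃ v ∈ S, a ∈ W v u}`. -/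
def gStep {V A : Type*} (W : V → V → Finset A) (S : Set V) (a : A) : Set V :=
  {u | ∃ v ∈ S, a ∈ W v u}

/-- Iterating `gStep` from `S` along the letters of the word `w`,
with `gRun W S [] = S`. -/
def gRun {V A : Type*} (W : V → V → Finset A) (S : Set V) (w : List A) : Set V :=
  w.foldl (gStep W) S

theorem gRun_cons {V A : Type*} (W : V → V → Finset A) (S : Set V) (a : A) (w : List A) :
    gRun W S (a :: w) = gRun W (gStep W S a) w := rfl

theorem gRun_append {V A : Type*} (W : V → V → Finset A) (S : Set V) (w w' : List A) :
    gRun W S (w ++ w') = gRun W (gRun W S w) w' := by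
  simp [gRun, List.foldl_append]

theorem gRun_union {V A : Type*} (W : V → V → Finset A) (w : List A) :
    ∀ S T : Set V, gRun W (S ∪ T) w = gRun W S w ∪ gRun W T w := by
  induction w with
  | nil => intro S T; rfl
  | cons a w ih =>
    intro S T
    have h : gStep W (S ∪ T) a = gStep W S a ∪ gStep W T a := by
      ext u
      simp only [gStep, Set.mem_union, Set.mem_setOf_eq]
      grind
    rw [gRun_cons, h, ih]; rfl

theorem gRun_empty {V A : Type*} (W : V → V → Finset A) (w : List A) :
    gRun W ∅ w = ∅ := by
  induction w with
  | nil => rfl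
  | cons a w ih =>
    have h : gStep W ∅ a = ∅ := by
      ext u
      simp [gStep]
    rw [gRun_cons, h, ih]

theorem gStep_subsingleton {V A : Type*} (W : V → V → Finset A)
    (hdet : ∀ (v u1 u2 : V), u1 ≠ u2 → Disjoint (W v u1) (W v u2))
    (S : Set V) (hS : S.Subsingleton) (a : A) : (gStep W S a).Subsingleton := by
  rintro u ⟨v, hv, hu⟩ u' ⟨v', hv', hu'⟩
  obtain rfl := hS hv hv'
  by_contra hne
  exact Finset.disjoint_left.mp (hdet v u u' hne) hu hu'

theorem gRun_subsingleton {V A : Type*} (W : V → V → Finset A)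
    (hdet : ∀ (v u1 u2 : V), u1 ≠ u2 → Disjoint (W v u1) (W v u2))
    (w : List A) : ∀ S : Set V, S.Subsingleton → (gRun W S w).Subsingleton := by
  induction w with
  | nil => intro S hS; exact hS
  | cons a w ih => intro S hS; exact ih _ (gStep_subsingleton W hdet S hS a)

theorem exists_kill {V A : Type*} (W : V → V → Finset A)
    (hdet : ∀ (v u1 u2 : V), u1 ≠ u2 → Disjoint (W v u1) (W v u2))
    (hk : ∀ v : V, ∃ w : List A, gRun W {v} w = ∅) (S : Set V) (hS : S.Finite) :
    ∃ w : List A, gRun W S w = ∅ := by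
  induction S, hS using Set.Finite.induction_on with
  | empty => exact ⟨[], rfl⟩
  | @insert v S _ _ ih =>
    obtain ⟨w, hw⟩ := ih
    rcases (gRun_subsingleton W hdet w {v} Set.subsingleton_singleton).eq_empty_or_singleton
      with h | ⟨u, h⟩
    · exact ⟨w, by rw [Set.insert_eq, gRun_union, hw, h, Set.union_empty]⟩
    · obtain ⟨w', hw'⟩ := hk u
      exact ⟨w ++ w', by
        rw [Set.insert_eq, gRun_append, gRun_union, hw, h, Set.union_empty, hw']⟩

theorem complete_run {V A : Type*} (W : V → V → Finset A) (P : Set V)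
    (hP : ∀ v ∈ P, ∀ a : A, ∃ u ∈ P, a ∈ W v u) (w : List A) :
    ∀ S : Set V, (S ∩ P).Nonempty → (gRun W S w ∩ P).Nonempty := by
  induction w with
  | nil => intro S hS; exact hS
  | cons a w ih =>
    rintro S ⟨v, hv, hvP⟩
    obtain ⟨u, hu, hau⟩ := hP v hvP a
    exact ih _ ⟨u, ⟨v, hv, hau⟩, hu⟩

/-- Under the determinism condition (weights of distinct outgoing edges of a common
vertex are disjoint), the determinized automaton built from the graph recognizes the
full language `A^*` (i.e. `V` is nonempty and the run from the full vertex set along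
every word is nonempty) iff the graph has a complete subgraph. -/
theorem full_language_iff_complete_subgraph
    {V A : Type*} [Fintype V] [Fintype A] [Nonempty A]
    (W : V → V → Finset A)
    (hdet : ∀ (v u1 u2 : V), u1 ≠ u2 → Disjoint (W v u1) (W v u2)) :
    ((Set.univ : Set V).Nonempty ∧
        ∀ w : List A, (gRun W Set.univ w).Nonempty) ↔
      ∃ P : Set V, CompleteSubgraph W P := by
  constructor
  · rintro ⟨_, hrun⟩
    refine ⟨{v | ∀ w : List A, (gRun W {v} w).Nonempty}, ?_, ?_⟩
    · by_contra hne
      have hk : ∀ v : V, ∃ w : List A, gRun W {v} w = ∅ := by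
        intro v
        by_contra hv
        push Not at hv
        exact hne ⟨v, hv⟩
      obtain ⟨w, hw⟩ := exists_kill W hdet hk Set.univ Set.finite_univ
      exact (hrun w).ne_empty hw
    · intro v hv a
      obtain ⟨u, hu⟩ : (gStep W {v} a).Nonempty := hv [a]
      have hs : gStep W {v} a = {u} :=
        (gStep_subsingleton W hdet {v} Set.subsingleton_singleton a).eq_singleton_of_mem hu
      refine ⟨u, ?_, ?_⟩
      · intro w
        have := hv (a :: w)
        rwa [gRun_cons, hs] at this
      · obtain ⟨v', hv', h⟩ := hu
        obtain rfl : v' = v := hv'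
        exact h
  · rintro ⟨P, ⟨v, hv⟩, hP⟩
    refine ⟨⟨v, trivial⟩, fun w => ?_⟩
    exact (complete_run W P hP w Set.univ ⟨v, trivial, hv⟩).mono Set.inter_subset_left
end

section
/- A BCN is not reconstructible if and only if its weighted pair graph has a complete subgraph; explicitly, if and only if there exists a nonempty set P of ordered pairs of states such that every (x, x') ∈ P satisfies x ≠ x' and h(x) = h(x'), and for every (x, x') ∈ P and every input u ∈ U the successor pair (f(u,x), f(u,x')) again lies in P. -/
/-- Changing the input at time `q` does not affect the trajectory up to time `q`. -/
theorem traj_update {X U : Type*} (f : U → X → X) (w : ℕ → U) (q : ℕ) (a : U)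
    (x : X) : ∀ i ≤ q, traj f (Function.update w q a) x i = traj f w x i
  | 0, _ => rfl
  | i + 1, hi => by
    have ih := traj_update f w q a x i (by omega)
    have hne : i ≠ q := by omega
    simp only [traj, ih, Function.update_of_ne hne]

/-- Pairs of initial states violating the homing property of a word. -/
def badPairs {X U Y : Type*} (f : U → X → X) (h : X → Y) (w : ℕ × (ℕ → U)) : Set (X × X) :=
  {v | (∀ i ≤ w.1, h (traj f w.2 v.1 i) = h (traj f w.2 v.2 i)) ∧
    traj f w.2 v.1 w.1 ≠ traj f w.2 v.2 w.1}

theorem homing_of_badPairs_empty {X U Y : Type*} (f : U → X → X) (h : X → Y) (p : ℕ) (u : ℕ → U)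
    (hB : badPairs f h (p, u) = ∅) : Homing f h p u := by
  intro x x' hx
  by_contra hne
  have : (x, x') ∈ badPairs f h (p, u) := ⟨hx, hne⟩
  rw [hB] at this
  exact this

theorem badPairs_update {X U Y : Type*} (f : U → X → X) (h : X → Y) (q : ℕ) (w : ℕ → U) (a : U) :
    badPairs f h (q + 1, Function.update w q a) ⊆ badPairs f h (q, w) := by
  rintro ⟨x, x'⟩ ⟨h1, h2⟩
  refine ⟨fun i hi => ?_, fun he => h2 ?_⟩
  · have := h1 i (Nat.le_succ_of_le hi)
    simpa only [traj_update f w q a _ i hi] using this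
  · simp only at he
    simp only [traj, traj_update f w q a _ q le_rfl, he]

/-- A BCN is not reconstructible iff its weighted pair graph has a complete
subgraph: a nonempty set `P` of (ordered) pairs of states such that every pair
in `P` consists of distinct states with the same output, and every pair in `P`
is mapped into `P` by every input. -/
theorem not_reconstructible_iff_complete_subgraph
    {X U Y : Type*} [Fintype X] [Fintype U] [Fintype Y]
    [Nonempty X] [Nonempty U] [Nonempty Y]
    (f : U → X → X) (h : X → Y) :
    ¬ Reconstructible f h ↔
      ∃ P : Set (X × X), P.Nonempty ∧
        (∀ v ∈ P, v.1 ≠ v.2 ∧ h v.1 = h v.2) ∧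
        (∀ v ∈ P, ∀ u : U, (f u v.1, f u v.2) ∈ P) := by
  classical
  constructor
  · intro hR
    obtain ⟨B, ⟨⟨⟨p, u⟩, hpu⟩, hmin⟩⟩ := Set.Finite.exists_minimal
      (Set.toFinite (Set.range (badPairs (U := U) f h))) (Set.range_nonempty _)
    refine ⟨{v | ∃ q w x x', badPairs f h (q, w) = B ∧ (x, x') ∈ B ∧
      v = (traj f w x q, traj f w x' q)}, ?_, ?_, ?_⟩
    · have hne : B.Nonempty := by
        rw [Set.nonempty_iff_ne_empty]
        intro h0
        exact hR ⟨p, u, homing_of_badPairs_empty f h p u (hpu.trans h0)⟩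
      obtain ⟨⟨x, x'⟩, hx⟩ := hne
      exact ⟨_, p, u, x, x', hpu, hx, rfl⟩
    · rintro v ⟨q, w, x, x', hB, hx, rfl⟩
      rw [← hB] at hx
      exact ⟨hx.2, hx.1 q le_rfl⟩
    · rintro v ⟨q, w, x, x', hB, hx, rfl⟩ a
      have hsub := badPairs_update f h q w a
      rw [hB] at hsub
      have hsup := hmin ⟨_, rfl⟩ hsub
      refine ⟨q + 1, Function.update w q a, x, x', Set.Subset.antisymm hsub hsup, hx, ?_⟩
      simp [traj, traj_update f w q a _ q le_rfl]
  · rintro ⟨P, ⟨v, hv⟩, hP, hstep⟩ ⟨p, u, hu⟩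
    have key : ∀ i, (traj f u v.1 i, traj f u v.2 i) ∈ P := by
      intro i
      induction i with
      | zero => exact hv
      | succ i ih => exact hstep _ ih (u i)
    exact (hP _ (key p)).1 (hu v.1 v.2 fun i _ => (hP _ (key i)).2)
end

section
/- A BCN is not Fornasini-reconstructible if and only if its weighted pair graph has a cycle; explicitly, if and only if there exist k ≥ 1, inputs u_0, …, u_{k-1} ∈ U, and states x_0, …, x_k and x̄_0, …, x̄_k with x_{i+1} = f(u_i, x_i) and x̄_{i+1} = f(u_i, x̄_i) for 0 ≤ i < k, x_i ≠ x̄_i and h(x_i) = h(x̄_i) for all 0 ≤ i ≤ k, and {x_k, x̄_k} = {x_0, x̄_0} (i.e., either x_k = x_0 and x̄_k = x̄_0, or x_k = x̄_0 and x̄_k = x_0). -/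
theorem traj_shift_aux {X U : Type*} (f : U → X → X) (u : ℕ → U) (x0 : X) (a n : ℕ) :
    traj f (fun m => u (a + m)) (traj f u x0 a) n = traj f u x0 (a + n) := by
  induction n with
  | zero => rfl
  | succ n ih =>
    show f (u (a + n)) _ = f (u (a + n)) (traj f u x0 (a + n))
    rw [ih]

theorem traj_eq_of_le_aux {X U : Type*} (f : U → X → X) (u : ℕ → U) (x x' : X) (a p : ℕ)
    (hap : a ≤ p) (he : traj f u x a = traj f u x' a) : traj f u x p = traj f u x' p := by
  obtain ⟨n, rfl⟩ := Nat.exists_eq_add_of_le hap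
  rw [← traj_shift_aux, ← traj_shift_aux, he]

theorem traj_cycle_aux {X U : Type*} (f : U → X → X) (u : ℕ → U) (x x' : X) (k : ℕ)
    (hk : 1 ≤ k)
    (hc : (traj f u x k = x ∧ traj f u x' k = x') ∨
      (traj f u x k = x' ∧ traj f u x' k = x)) (n : ℕ) :
    (traj f (fun m => u (m % k)) x n = traj f u x (n % k) ∧
      traj f (fun m => u (m % k)) x' n = traj f u x' (n % k)) ∨
    (traj f (fun m => u (m % k)) x n = traj f u x' (n % k) ∧
      traj f (fun m => u (m % k)) x' n = traj f u x (n % k)) := by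
  induction n with
  | zero => left; simp [traj]
  | succ n ih =>
    have hs : ∀ y, traj f (fun m => u (m % k)) y (n + 1)
        = f (u (n % k)) (traj f (fun m => u (m % k)) y n) := fun y => rfl
    have ht : ∀ y, f (u (n % k)) (traj f u y (n % k)) = traj f u y (n % k + 1) := fun y => rfl
    have h0 : ∀ y, traj f u y 0 = y := fun y => rfl
    have hlt : n % k < k := Nat.mod_lt _ hk
    rw [hs, hs]
    by_cases hkk : n % k + 1 = k
    · have hz : (n + 1) % k = 0 := by
        rw [← Nat.mod_add_mod, hkk, Nat.mod_self]
      rw [hz, h0, h0]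
      rcases ih with ⟨h1, h2⟩ | ⟨h1, h2⟩ <;> rw [h1, h2, ht, ht, hkk] <;> tauto
    · have hz : (n + 1) % k = n % k + 1 := by
        rw [← Nat.mod_add_mod, Nat.mod_eq_of_lt (by omega)]
      rw [hz]
      rcases ih with ⟨h1, h2⟩ | ⟨h1, h2⟩ <;> rw [h1, h2, ht, ht] <;> tauto

/-- A BCN is not Fornasini-reconstructible iff its weighted pair graph has a cycle:
there exist `k ≥ 1`, inputs `u 0, …, u (k-1)` and two state trajectories that are
pointwise distinct on `[0, k]`, produce the same outputs on `[0, k]`, and whose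
pair of states at time `k` equals (as an unordered pair) the pair at time `0`. -/
theorem not_fornasini_reconstructible_iff_cycle
    {X U Y : Type*} [Fintype X] [Fintype U] [Fintype Y]
    [Nonempty X] [Nonempty U] [Nonempty Y]
    (f : U → X → X) (h : X → Y) :
    ¬ FornasiniReconstructible f h ↔
      ∃ k : ℕ, 1 ≤ k ∧ ∃ (u : ℕ → U) (x0 x0' : X),
        (∀ i ≤ k, traj f u x0 i ≠ traj f u x0' i) ∧
        (∀ i ≤ k, h (traj f u x0 i) = h (traj f u x0' i)) ∧
        ((traj f u x0 k = x0 ∧ traj f u x0' k = x0') ∨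
          (traj f u x0 k = x0' ∧ traj f u x0' k = x0)) := by
  constructor
  · intro hn
    simp only [FornasiniReconstructible, Homing] at hn
    push Not at hn
    obtain ⟨u, x, x', ho, hne⟩ := hn (Fintype.card (X × X))
    have hne' : ∀ i ≤ Fintype.card (X × X), traj f u x i ≠ traj f u x' i :=
      fun i hi he => hne (traj_eq_of_le_aux f u x x' i _ hi he)
    obtain ⟨i, j, hij, he⟩ := Fintype.exists_ne_map_eq_of_card_lt
      (fun i : Fin (Fintype.card (X × X) + 1) => (traj f u x i, traj f u x' i)) (by simp)
    wlog hlt : i < j generalizing i j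
    · exact this j i hij.symm he.symm (lt_of_le_of_ne (not_lt.mp hlt) hij.symm)
    have hlt' : (i : ℕ) < j := hlt
    have hj := j.2
    simp only [Prod.mk.injEq] at he
    refine ⟨j - i, by omega, fun m => u (i + m), traj f u x i, traj f u x' i, ?_, ?_, Or.inl ?_⟩
    · intro m hm
      rw [traj_shift_aux, traj_shift_aux]
      exact hne' _ (by omega)
    · intro m hm
      rw [traj_shift_aux, traj_shift_aux]
      exact ho _ (by omega)
    · rw [traj_shift_aux, traj_shift_aux, Nat.add_sub_cancel' hlt'.le]
      exact ⟨he.1.symm, he.2.symm⟩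
  · rintro ⟨k, hk, u, x, x', hne, ho, hc⟩ ⟨p, hp⟩
    have key := traj_cycle_aux f u x x' k hk hc
    have hle : ∀ n, n % k ≤ k := fun n => (Nat.mod_lt n hk).le
    have := hp (fun m => u (m % k)) x x' (by
      intro i _
      rcases key i with ⟨h1, h2⟩ | ⟨h1, h2⟩ <;> rw [h1, h2]
      · exact ho _ (hle i)
      · exact (ho _ (hle i)).symm)
    rcases key p with ⟨h1, h2⟩ | ⟨h1, h2⟩ <;> rw [h1, h2] at this
    · exact hne _ (hle p) this
    · exact hne _ (hle p) this.symm
end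

section
/- For every integer N ≥ 3, the BCN with state set X = ZMod N, input set U = ZMod N, output set Y = Unit (constant output map), and transition map f(u, x) = u + 1 if x = u and f(u, x) = u if x ≠ u, is not Fornasini-reconstructible. In particular, reconstructibility and Fornasini-reconstructibility are not equivalent notions. -/
theorem bcn_aux (N : ℕ) (hN : 3 ≤ N) :
    ¬ FornasiniReconstructible (fun u x : ZMod N => if x = u then u + 1 else u)
        (fun _ : ZMod N => ()) := by
  rintro ⟨p, hp⟩
  haveI : Fact (1 < N) := ⟨by omega⟩
  have h01 : (0 : ZMod N) ≠ 1 := zero_ne_one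
  have key : ∀ n : ℕ,
      (traj (fun u x : ZMod N => if x = u then u + 1 else u) (fun _ => 0) 0 n = 0 ∧
        traj (fun u x : ZMod N => if x = u then u + 1 else u) (fun _ => 0) 1 n = 1) ∨
      (traj (fun u x : ZMod N => if x = u then u + 1 else u) (fun _ => 0) 0 n = 1 ∧
        traj (fun u x : ZMod N => if x = u then u + 1 else u) (fun _ => 0) 1 n = 0) := by
    intro n
    induction n with
    | zero => left; exact ⟨rfl, rfl⟩
    | succ k ih =>
      rcases ih with ⟨h1, h2⟩ | ⟨h1, h2⟩
      · right; simp [traj, h1, h2]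
      · left; simp [traj, h1, h2]
  have h := hp (fun _ => 0) 0 1 (fun _ _ => rfl)
  rcases key p with ⟨h1, h2⟩ | ⟨h1, h2⟩
  · exact h01 (h1.symm.trans (h.trans h2))
  · exact h01 (h2.symm.trans (h.symm.trans h1))

/-- For every `N ≥ 3`, the BCN on `ZMod N` with constant output map and transition
`f u x = u + 1` if `x = u`, `f u x = u` otherwise, is not Fornasini-reconstructible.
In particular, reconstructibility and Fornasini-reconstructibility are not
equivalent notions (for finite nonempty BCNs). -/
theorem example_bcn_not_fornasini_reconstructible (N : ℕ) (hN : 3 ≤ N) :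
    ¬ FornasiniReconstructible (fun u x : ZMod N => if x = u then u + 1 else u)
        (fun _ : ZMod N => ()) ∧
      ¬ (∀ (X U Y : Type) [Fintype X] [Fintype U] [Fintype Y]
          [Nonempty X] [Nonempty U] [Nonempty Y]
          (f : U → X → X) (h : X → Y),
          Reconstructible f h ↔ FornasiniReconstructible f h) := by
  refine ⟨bcn_aux N hN, fun H => ?_⟩
  refine bcn_aux 3 le_rfl ((H (ZMod 3) (ZMod 3) Unit _ _).1 ?_)
  refine ⟨2, fun i => if i = 0 then 0 else 2, fun x y _ => ?_⟩
  revert x y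
  simp only [traj]
  decide
end

section
/- For every integer N ≥ 3, the BCN with state set X = ZMod N, input set U = ZMod N, output set Y = Unit (constant output map), and transition map f(u, x) = x + 1 if u = x and f(u, x) = x if u ≠ x, is reconstructible. -/
/-- For every `N ≥ 3`, the BCN on `ZMod N` with constant output map and transition
`f u x = x + 1` if `u = x`, `f u x = x` otherwise, is reconstructible. -/
theorem example_bcn2_reconstructible (N : ℕ) (hN : 3 ≤ N) :
    Reconstructible (fun u x : ZMod N => if u = x then x + 1 else x)
      (fun _ : ZMod N => ()) := by
  haveI : NeZero N := ⟨by omega⟩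
  have key : ∀ (x : ZMod N) (i : ℕ), i ≤ N - 1 →
      traj (fun u x : ZMod N => if u = x then x + 1 else x) (fun i => (i : ZMod N)) x i
        = ((max x.val i : ℕ) : ZMod N) := by
    intro x i
    induction i with
    | zero => intro _; simp [traj]
    | succ k ih =>
      intro hk
      have hx := ZMod.val_lt x
      simp only [traj]
      rw [ih (by omega)]
      rcases le_or_gt x.val k with h | h
      · rw [max_eq_right h, max_eq_right (by omega), if_pos rfl]
        push_cast
        rfl
      · rw [max_eq_left (by omega), max_eq_left (by omega), if_neg]
        intro e
        have := congrArg ZMod.val e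
        rw [ZMod.val_natCast_of_lt (by omega), ZMod.val_natCast_of_lt (by omega)] at this
        omega
  refine ⟨N - 1, fun i => (i : ZMod N), fun x y _ => ?_⟩
  have hx := ZMod.val_lt x
  have hy := ZMod.val_lt y
  rw [key x _ le_rfl, key y _ le_rfl, max_eq_right (by omega), max_eq_right (by omega)]
end

section
/- Let X, Y be finite nonempty types, f : X → X, h : X → Y, and suppose the state transition graph of the Boolean network is a single cycle through all states, i.e., for every x ∈ X the orbit {f^[k](x) | k ∈ ℕ} is all of X. Then the Boolean network is observable if and only if it is reconstructible. -/
/-- For a Boolean network `(f, h)` whose state transition graph is a single cycle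
through all states (every state's forward orbit is the whole state space),
observability is equivalent to reconstructibility. -/
theorem bn_cycle_observable_iff_reconstructible
    {X Y : Type*} [Fintype X] [Fintype Y] [Nonempty X] [Nonempty Y]
    (f : X → X) (h : X → Y)
    (hcyc : ∀ x y : X, ∃ k : ℕ, f^[k] x = y) :
    (∀ x x' : X, x ≠ x' → ∃ k : ℕ, h (f^[k] x) ≠ h (f^[k] x')) ↔
      (∃ p : ℕ, ∀ x x' : X, x ≠ x' → f^[p] x ≠ f^[p] x' →
        ∃ k ≤ p, h (f^[k] x) ≠ h (f^[k] x')) := by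
  constructor
  · intro hobs
    have H : ∀ q : X × X, ∃ k : ℕ, q.1 ≠ q.2 → h (f^[k] q.1) ≠ h (f^[k] q.2) := by
      intro q
      by_cases hq : q.1 = q.2
      · exact ⟨0, fun hne => absurd hq hne⟩
      · obtain ⟨k, hk⟩ := hobs q.1 q.2 hq
        exact ⟨k, fun _ => hk⟩
    choose K hK using H
    refine ⟨Finset.univ.sup K, fun x x' hne _ => ⟨K (x, x'), ?_, hK (x, x') hne⟩⟩
    exact Finset.le_sup (f := K) (Finset.mem_univ (x, x'))
  · rintro ⟨p, hp⟩ x x' hne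
    have hsurj : Function.Surjective f := by
      intro y
      obtain ⟨k, hk⟩ := hcyc (f y) y
      refine ⟨f^[k] y, ?_⟩
      rw [← Function.iterate_succ_apply' f k y, Function.iterate_succ_apply]
      exact hk
    have hinj : Function.Injective f := Finite.injective_iff_surjective.mpr hsurj
    obtain ⟨k, _, hk⟩ := hp x x' hne (fun e => hne (hinj.iterate p e))
    exact ⟨k, hk⟩
end

section
/- A BCN is not Fornasini-reconstructible if and only if there exist k ≥ 1, inputs u_0, …, u_{k-1} ∈ U, and two periodic state trajectories x_0, …, x_k and x̄_0, …, x̄_k with x_{i+1} = f(u_i, x_i) and x̄_{i+1} = f(u_i, x̄_i) for 0 ≤ i < k, x_k = x_0 and x̄_k = x̄_0, x_j ≠ x̄_j for some 0 ≤ j ≤ k, and h(x_i) = h(x̄_i) for all 0 ≤ i ≤ k. (Equivalently: the BCN is Fornasini-reconstructible iff every pair of different periodic state trajectories driven by the same periodic input sequence yields different output trajectories.) -/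
theorem traj_add_aux {X U : Type*} (f : U → X → X) (u : ℕ → U) (x0 : X) (i n : ℕ) :
    traj f u x0 (i + n) = traj f (fun m => u (i + m)) (traj f u x0 i) n := by
  induction n with
  | zero => rfl
  | succ n ih =>
    change f (u (i + n)) (traj f u x0 (i + n)) = f (u (i + n)) _
    rw [ih]

theorem traj_merge_aux {X U : Type*} (f : U → X → X) (u : ℕ → U) (x0 x0' : X) (i n : ℕ)
    (hin : i ≤ n) (he : traj f u x0 i = traj f u x0' i) :
    traj f u x0 n = traj f u x0' n := by
  obtain ⟨m, rfl⟩ := Nat.exists_eq_add_of_le hin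
  rw [traj_add_aux, traj_add_aux, he]

theorem traj_periodic_aux {X U : Type*} (f : U → X → X) (u : ℕ → U) (x0 : X) (k : ℕ)
    (hk : 1 ≤ k) (hx : traj f u x0 k = x0) (n : ℕ) :
    traj f (fun m => u (m % k)) x0 n = traj f u x0 (n % k) := by
  induction n with
  | zero => simp [traj]
  | succ n ih =>
    change f (u (n % k)) (traj f (fun m => u (m % k)) x0 n) = _
    rw [ih]
    change traj f u x0 (n % k + 1) = _
    have hlt := Nat.mod_lt n hk
    rcases Nat.lt_or_ge (n % k + 1) k with h1 | h1
    · rw [Nat.add_mod n 1 k, ← Nat.add_mod, ← Nat.mod_add_mod, Nat.mod_eq_of_lt h1]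
    · have h2 : n % k + 1 = k := by omega
      rw [← Nat.mod_add_mod, h2, Nat.mod_self, hx]
      rfl

/-- A BCN is not Fornasini-reconstructible iff there exist `k ≥ 1`, inputs
`u 0, …, u (k-1)` and two periodic state trajectories (each returning to its
initial state at time `k`) that differ at some time `j ≤ k` but produce the
same output sequence on `[0, k]`. -/
theorem not_fornasini_reconstructible_iff_periodic_trajectories
    {X U Y : Type*} [Fintype X] [Fintype U] [Fintype Y]
    [Nonempty X] [Nonempty U] [Nonempty Y]
    (f : U → X → X) (h : X → Y) :
    ¬ FornasiniReconstructible f h ↔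
      ∃ k : ℕ, 1 ≤ k ∧ ∃ (u : ℕ → U) (x0 x0' : X),
        traj f u x0 k = x0 ∧ traj f u x0' k = x0' ∧
        (∃ j ≤ k, traj f u x0 j ≠ traj f u x0' j) ∧
        (∀ i ≤ k, h (traj f u x0 i) = h (traj f u x0' i)) := by
  constructor
  · intro hn
    unfold FornasiniReconstructible at hn
    push Not at hn
    obtain ⟨u, hu⟩ := hn (Fintype.card (X × X))
    unfold Homing at hu
    push Not at hu
    obtain ⟨x0, x0', ho, hne⟩ := hu
    obtain ⟨a, b, hab, he⟩ := Fintype.exists_ne_map_eq_of_card_lt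
      (fun i : Fin (Fintype.card (X × X) + 1) => (traj f u x0 i, traj f u x0' i)) (by simp)
    wlog hlt : a < b generalizing a b
    · exact this b a hab.symm he.symm (lt_of_le_of_ne (not_lt.mp hlt) hab.symm)
    have hlt' : (a : ℕ) < b := hlt
    have hb := b.2
    simp only [Prod.mk.injEq] at he
    obtain ⟨e1, e2⟩ := he
    refine ⟨b - a, by omega, fun m => u (a + m), traj f u x0 a, traj f u x0' a, ?_, ?_, ?_, ?_⟩
    · rw [← traj_add_aux, Nat.add_sub_cancel' hlt'.le, e1]
    · rw [← traj_add_aux, Nat.add_sub_cancel' hlt'.le, e2]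
    · refine ⟨0, by omega, fun h0 => hne ?_⟩
      exact traj_merge_aux f u x0 x0' a _ (by omega) h0
    · intro i hi
      rw [← traj_add_aux, ← traj_add_aux]
      exact ho _ (by omega)
  · rintro ⟨k, hk, u, x0, x0', hx, hx', ⟨j, hj, hne⟩, ho⟩ ⟨p, hp⟩
    have hlt := Nat.mod_lt p hk
    have key := hp (fun m => u (m % k)) x0 x0' (by
      intro i _
      rw [traj_periodic_aux f u x0 k hk hx, traj_periodic_aux f u x0' k hk hx']
      exact ho _ (Nat.mod_lt i hk).le)
    rw [traj_periodic_aux f u x0 k hk hx, traj_periodic_aux f u x0' k hk hx'] at key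
    have e := traj_merge_aux f u x0 x0' _ k hlt.le key
    rw [hx, hx'] at e
    exact hne (by rw [e])
end

section
/- Let n ≥ 1 and define F : (Fin n → ZMod 2) → (Fin n → ZMod 2) by F(x)(k) = x(k) + ∏_{j > k} x(j), where the product over the empty index set is 1 (so F(x)(n-1) = x(n-1) + 1). Then F is a bijection whose state transition graph is a single cycle of length 2^n: for every x, the orbit {F^[m](x) | m ∈ ℕ} is the whole space Fin n → ZMod 2, and the least m ≥ 1 with F^[m](x) = x equals 2^n. -/
/-- The transition map of the autonomous Boolean network of equation (7):
`F x k = x k + ∏_{j > k} x j` (the empty product being `1`, so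
`F x (n-1) = x (n-1) + 1`). -/
def cycleBN (n : ℕ) : (Fin n → ZMod 2) → (Fin n → ZMod 2) :=
  fun x k => x k + ∏ j ∈ Finset.univ.filter (fun j => k < j), x j

/-- binary value of a state -/
def cbnVal : (n : ℕ) → (Fin n → ZMod 2) → ℕ
  | 0, _ => 0
  | n + 1, x => (x 0).val * 2 ^ n + cbnVal n (fun i => x i.succ)

theorem cbnVal_lt (n : ℕ) (x : Fin n → ZMod 2) : cbnVal n x < 2 ^ n := by
  induction n with
  | zero => simp [cbnVal]
  | succ n ih =>
    have h := ih (fun i => x i.succ)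
    have h2 : (x 0).val ≤ 1 := by have := ZMod.val_lt (x 0); omega
    have h3 := Nat.mul_le_mul_right (2 ^ n) h2
    simp only [cbnVal, pow_succ]
    omega

theorem cbnVal_inj (n : ℕ) (x y : Fin n → ZMod 2) (h : cbnVal n x = cbnVal n y) : x = y := by
  induction n with
  | zero => exact Subsingleton.elim _ _
  | succ n ih =>
    have hx := cbnVal_lt n (fun i => x i.succ)
    have hy := cbnVal_lt n (fun i => y i.succ)
    simp only [cbnVal] at h
    have hp : 0 < 2 ^ n := by positivity
    have h0 : (x 0).val = (y 0).val := by
      have := congrArg (· / 2 ^ n) h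
      simpa [Nat.mul_comm _ (2 ^ n), Nat.mul_add_div hp, Nat.div_eq_of_lt hx,
        Nat.div_eq_of_lt hy] using this
    rw [h0] at h
    have h1 := ih _ _ (Nat.add_left_cancel h)
    funext i
    refine Fin.cases ?_ (fun j => ?_) i
    · exact ZMod.val_injective 2 h0
    · exact congrFun h1 j

theorem cycleBN_zero' (n : ℕ) (x : Fin (n + 1) → ZMod 2) :
    cycleBN (n + 1) x 0 = x 0 + ∏ j, x (Fin.succ j) := by
  simp [cycleBN, Finset.prod_filter, Fin.prod_univ_succ]

theorem cycleBN_succ' (n : ℕ) (x : Fin (n + 1) → ZMod 2) :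
    (fun i : Fin n => cycleBN (n + 1) x i.succ) = cycleBN n (fun i => x i.succ) := by
  funext i
  simp [cycleBN, Finset.prod_filter, Fin.prod_univ_succ]

theorem cbnVal_step (n : ℕ) (x : Fin n → ZMod 2) :
    cbnVal n (cycleBN n x) + 2 ^ n * (∏ j, x j).val = cbnVal n x + 1 := by
  induction n with
  | zero => simp [cbnVal]; rfl
  | succ n ih =>
    have h := ih (fun i => x i.succ)
    have key : ∀ a P : ZMod 2, (a + P).val + 2 * (a * P).val = a.val + P.val := by decide
    have k := key (x 0) (∏ j, x (Fin.succ j))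
    simp only [cbnVal, cycleBN_zero', cycleBN_succ', Fin.prod_univ_succ, pow_succ]
    linear_combination h + 2 ^ n * k

theorem cbnVal_iter (n : ℕ) (x : Fin n → ZMod 2) (m : ℕ) :
    cbnVal n ((cycleBN n)^[m] x) ≡ cbnVal n x + m [MOD 2 ^ n] := by
  induction m with
  | zero => exact Nat.ModEq.refl _
  | succ m ih =>
    rw [Function.iterate_succ_apply']
    have h := cbnVal_step n ((cycleBN n)^[m] x)
    have h2 : cbnVal n (cycleBN n ((cycleBN n)^[m] x)) ≡
        cbnVal n ((cycleBN n)^[m] x) + 1 [MOD 2 ^ n] := by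
      rw [← h]; simp [Nat.ModEq]
    exact h2.trans (ih.add_right 1)

theorem cbn_iter_eq_iff (n : ℕ) (x y : Fin n → ZMod 2) (m : ℕ) :
    (cycleBN n)^[m] x = y ↔ cbnVal n x + m ≡ cbnVal n y [MOD 2 ^ n] := by
  constructor
  · rintro rfl
    exact (cbnVal_iter n x m).symm
  · intro h
    exact cbnVal_inj _ _ _
      (((cbnVal_iter n x m).trans h).eq_of_lt_of_lt (cbnVal_lt _ _) (cbnVal_lt _ _))

/-- For `n ≥ 1`, the map `cycleBN n` is a bijection whose state transition graph
is a single cycle of length `2 ^ n`: every state's forward orbit is the whole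
space, and the least `m ≥ 1` with `(cycleBN n)^[m] x = x` equals `2 ^ n`. -/
theorem cycleBN_single_cycle (n : ℕ) (hn : 1 ≤ n) :
    Function.Bijective (cycleBN n) ∧
      (∀ x y : Fin n → ZMod 2, ∃ m : ℕ, (cycleBN n)^[m] x = y) ∧
      (∀ x : Fin n → ZMod 2, Function.minimalPeriod (cycleBN n) x = 2 ^ n) := by
  have htr : ∀ x y : Fin n → ZMod 2, ∃ m : ℕ, (cycleBN n)^[m] x = y := by
    intro x y
    refine ⟨cbnVal n y + (2 ^ n - cbnVal n x), (cbn_iter_eq_iff n x y _).2 ?_⟩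
    have := cbnVal_lt n x
    rw [show cbnVal n x + (cbnVal n y + (2 ^ n - cbnVal n x)) = cbnVal n y + 2 ^ n by omega]
    simp [Nat.ModEq]
  refine ⟨?_, htr, ?_⟩
  · apply Function.Surjective.bijective_of_finite
    intro y
    obtain ⟨m, hm⟩ := htr (cycleBN n y) y
    exact ⟨(cycleBN n)^[m] y, by
      rw [← Function.iterate_succ_apply' (cycleBN n), Function.iterate_succ_apply]; exact hm⟩
  · intro x
    apply Nat.dvd_antisymm
    · apply Function.IsPeriodicPt.minimalPeriod_dvd
      exact (cbn_iter_eq_iff n x x _).2 (by simp [Nat.ModEq])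
    · have h := (cbn_iter_eq_iff n x x _).1 (Function.iterate_minimalPeriod (f := cycleBN n) (x := x))
      have h2 : cbnVal n x + Function.minimalPeriod (cycleBN n) x ≡ cbnVal n x + 0 [MOD 2 ^ n] := h
      exact (Nat.modEq_zero_iff_dvd).1 (Nat.ModEq.add_left_cancel' _ h2)
end
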